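/- Let (Ω,μ,T) be a weak mixing probability measure-preserving system, let α ∈ (0,1) be irrational, let I ⊆ [0,1) be a finite union of intervals and let F: Ω → ℝ be bounded and measurable. Then there is a set Ω' ⊆ Ω of full μ-measure such that for all ω ∈ Ω' and all t ∈ [0,1): (1/N) ∑_{k=1}^N 𝟙_I({t+kα}) · F(T^{l_k(t)} ω) → λ(I) · E_μ[F] as N → ∞. -/

import Mathlib

open MeasureTheory Filter Topology

/-- A probability measure-preserving system `(Ω, μ, T)` is weak mixing if the product
system `(Ω × Ω, μ × μ, T × T)` is ergodic. -/
def WeakMixing {Ω : Type*} [MeasurableSpace Ω] (T : Ω → Ω) (μ : Measure Ω) : Prop :=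
  Ergodic (Prod.map T T) (μ.prod μ)

/-- `l_k(t) = ⌊t + α k⌋` (as a natural number). -/
noncomputable def lk (α t : ℝ) (k : ℕ) : ℕ := (⌊t + α * k⌋).toNat

/-- A finite union of (half-open) intervals in `ℝ`. -/
def IsFinUnionIntervals (I : Set ℝ) : Prop :=
  ∃ s : Finset (ℝ × ℝ), I = ⋃ p ∈ s, Set.Ico p.1 p.2

section birkhoffMax

/-- The running maximum `max_{0 ≤ k ≤ N} ∑_{n < k} h ∘ T^n`, defined recursively. -/
noncomputable def birkhoffMax {Ω : Type*} (T : Ω → Ω) (h : Ω → ℝ) : ℕ → Ω → ℝ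
  | 0, _ => 0
  | N + 1, ω => max 0 (h ω + birkhoffMax T h N (T ω))

variable {Ω : Type*} {T : Ω → Ω} {h : Ω → ℝ}

lemma birkhoffMax_nonneg (N : ℕ) (ω : Ω) : 0 ≤ birkhoffMax T h N ω := by
  cases N with
  | zero => exact le_rfl
  | succ N => exact le_max_left _ _

lemma birkhoffMax_le_succ (N : ℕ) (ω : Ω) :
    birkhoffMax T h N ω ≤ birkhoffMax T h (N + 1) ω := by
  induction N generalizing ω with
  | zero => exact le_max_left _ _
  | succ N ih =>
    have := ih (T ω)
    rw [birkhoffMax, birkhoffMax]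
    gcongr

lemma birkhoffMax_le_add (N : ℕ) {ω : Ω} (hω : 0 < birkhoffMax T h N ω) :
    birkhoffMax T h N ω ≤ h ω + birkhoffMax T h N (T ω) := by
  cases N with
  | zero => exact absurd hω (lt_irrefl _)
  | succ N =>
    rw [birkhoffMax] at hω
    rw [birkhoffMax, max_eq_right ((lt_max_iff.1 hω).resolve_left (lt_irrefl _)).le]
    gcongr
    exact birkhoffMax_le_succ N (T ω)

lemma birkhoffSum_le_birkhoffMax (N : ℕ) (ω : Ω) :
    birkhoffSum T h N ω ≤ birkhoffMax T h N ω := by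
  induction N generalizing ω with
  | zero => simp [birkhoffMax]
  | succ N ih =>
    rw [birkhoffSum_succ', birkhoffMax]
    exact le_max_of_le_right (by gcongr; exact ih _)

variable [MeasurableSpace Ω] {μ : Measure Ω}

lemma integrable_birkhoffMax (hT : MeasurePreserving T μ μ) (hh : Integrable h μ) (N : ℕ) :
    Integrable (birkhoffMax T h N) μ := by
  induction N with
  | zero => exact integrable_zero _ _ _
  | succ N ih => exact (integrable_zero _ _ _).sup (hh.add (hT.integrable_comp_of_integrable ih))

lemma measurable_birkhoffMax (hT : Measurable T) (hh : Measurable h) (N : ℕ) :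
    Measurable (birkhoffMax T h N) := by
  induction N with
  | zero => exact measurable_const
  | succ N ih => exact measurable_const.max (hh.add (ih.comp hT))

/-- The **maximal ergodic theorem**. -/
theorem setIntegral_birkhoffMax_pos_nonneg (hT : MeasurePreserving T μ μ) (hm : Measurable h)
    (hh : Integrable h μ) (N : ℕ) : 0 ≤ ∫ ω in {ω | 0 < birkhoffMax T h N ω}, h ω ∂μ := by
  have hM := integrable_birkhoffMax hT hh N
  have hMT : Integrable (fun ω => birkhoffMax T h N (T ω)) μ :=
    hT.integrable_comp_of_integrable hM
  have hE : MeasurableSet {ω | 0 < birkhoffMax T h N ω} :=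
    measurableSet_lt measurable_const (measurable_birkhoffMax hT.measurable hm N)
  have h1 : ∫ ω, birkhoffMax T h N (T ω) ∂μ = ∫ ω, birkhoffMax T h N ω ∂μ := by
    conv_rhs => rw [← hT.map_eq]
    rw [integral_map hT.aemeasurable]
    rw [hT.map_eq]
    exact hM.aestronglyMeasurable
  have h2 : ∫ ω, (birkhoffMax T h N ω - birkhoffMax T h N (T ω)) ∂μ
      ≤ ∫ ω, Set.indicator {ω | 0 < birkhoffMax T h N ω} h ω ∂μ := by
    refine integral_mono (hM.sub hMT) (hh.indicator hE) fun ω => ?_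
    by_cases hω : 0 < birkhoffMax T h N ω
    · rw [Set.indicator_of_mem (by exact hω)]
      linarith [birkhoffMax_le_add N hω]
    · rw [Set.indicator_of_notMem (by exact hω)]
      linarith [birkhoffMax_nonneg (T := T) (h := h) N (T ω)]
  rwa [integral_indicator hE, integral_sub hM hMT, h1, sub_self] at h2

/-- The weak-type maximal inequality for Birkhoff sums. -/
theorem mul_measureReal_exists_lt_birkhoffSum_le [IsProbabilityMeasure μ]
    (hT : MeasurePreserving T μ μ) {g : Ω → ℝ} (hm : Measurable g) (hg : Integrable g μ)
    (hg0 : ∀ ω, 0 ≤ g ω) {c : ℝ} (hc : 0 ≤ c) :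
    c * μ.real {ω | ∃ N : ℕ, N * c < birkhoffSum T g N ω} ≤ ∫ ω, g ω ∂μ := by
  set h : Ω → ℝ := fun ω => g ω - c with hh
  have hhi : Integrable h μ := hg.sub (integrable_const c)
  have hhm : Measurable h := hm.sub_const c
  set E : ℕ → Set Ω := fun N => {ω | 0 < birkhoffMax T h N ω} with hE
  have hEm (N : ℕ) : MeasurableSet (E N) :=
    measurableSet_lt measurable_const (measurable_birkhoffMax hT.measurable hhm N)
  have hmono : Monotone E := monotone_nat_of_le_succ fun N ω hω =>
    lt_of_lt_of_le (by exact hω) (birkhoffMax_le_succ N ω)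
  have hle (N : ℕ) : c * μ.real (E N) ≤ ∫ ω, g ω ∂μ := by
    have h0 := setIntegral_birkhoffMax_pos_nonneg hT hhm hhi N
    rw [hh, integral_sub hg.integrableOn (integrable_const c).integrableOn] at h0
    simp only [integral_const, measureReal_restrict_apply_univ, smul_eq_mul] at h0
    have := setIntegral_le_integral (s := E N) hg (Eventually.of_forall hg0)
    linarith [mul_comm c (μ.real (E N))]
  have hlim : Tendsto (fun N => μ.real (E N)) atTop (𝓝 (μ.real (⋃ N, E N))) :=
    (ENNReal.tendsto_toReal (measure_ne_top _ _)).comp (tendsto_measure_iUnion_atTop hmono)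
  have hsub : {ω | ∃ N : ℕ, N * c < birkhoffSum T g N ω} ⊆ ⋃ N, E N := by
    rintro ω ⟨N, hN⟩
    refine Set.mem_iUnion.2 ⟨N, lt_of_lt_of_le ?_ (birkhoffSum_le_birkhoffMax N ω)⟩
    simpa [birkhoffSum, hh] using hN
  exact (mul_le_mul_of_nonneg_left (measureReal_mono hsub) hc).trans
    (le_of_tendsto' (hlim.const_mul c) hle)

end birkhoffMax

lemma norm_sum_range_add_sub_sum_range_le {u : ℕ → ℂ} {C : ℝ} (hu : ∀ n, ‖u n‖ ≤ C) (N j : ℕ) :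
    ‖∑ n ∈ Finset.range N, u (n + j) - ∑ n ∈ Finset.range N, u n‖ ≤ 2 * j * C := by
  induction j with
  | zero => simp
  | succ j ih =>
    have h1 := Finset.sum_range_succ (fun n => u (n + j)) N
    rw [Finset.sum_range_succ'] at h1
    have h2 : ∑ n ∈ Finset.range N, u (n + (j + 1)) - ∑ n ∈ Finset.range N, u n
        = (∑ n ∈ Finset.range N, u (n + j) - ∑ n ∈ Finset.range N, u n)
          + (u (N + j) - u (0 + j)) := by
      simp only [show ∀ n, n + (j + 1) = n + 1 + j by intro n; ring]
      linear_combination h1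
    rw [h2]
    have := norm_add_le (∑ n ∈ Finset.range N, u (n + j) - ∑ n ∈ Finset.range N, u n)
      (u (N + j) - u (0 + j))
    have h3 := norm_sub_le (u (N + j)) (u (0 + j))
    push_cast
    linarith [hu (N + j), hu (0 + j)]

/-- Averaging a bounded sequence over windows of length `K` changes its partial sums by `O(1)`. -/
lemma norm_sum_range_sub_sum_window_le {u : ℕ → ℂ} {C : ℝ} (hu : ∀ n, ‖u n‖ ≤ C)
    {K : ℕ} (hK : 0 < K) (N : ℕ) :
    ‖∑ n ∈ Finset.range N, (K : ℂ)⁻¹ * ∑ j ∈ Finset.range K, u (n + j)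
      - ∑ n ∈ Finset.range N, u n‖ ≤ 2 * K * C := by
  have hK' : (K : ℂ) ≠ 0 := by exact_mod_cast hK.ne'
  have hC : 0 ≤ C := (norm_nonneg _).trans (hu 0)
  have h1 : ∑ n ∈ Finset.range N, (K : ℂ)⁻¹ * ∑ j ∈ Finset.range K, u (n + j)
      - ∑ n ∈ Finset.range N, u n = (K : ℂ)⁻¹ * ∑ j ∈ Finset.range K,
        (∑ n ∈ Finset.range N, u (n + j) - ∑ n ∈ Finset.range N, u n) := by
    rw [← Finset.mul_sum, Finset.sum_comm, Finset.sum_sub_distrib, mul_sub, Finset.sum_const,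
      Finset.card_range, nsmul_eq_mul, inv_mul_cancel_left₀ hK']
  rw [h1, norm_mul, norm_inv, Complex.norm_natCast, inv_mul_le_iff₀ (by exact_mod_cast hK)]
  refine (norm_sum_le_of_le (f := fun j => ∑ n ∈ Finset.range N, u (n + j)
    - ∑ n ∈ Finset.range N, u n) (n := fun _ => 2 * K * C) _ fun j hj => ?_).trans ?_
  · refine (norm_sum_range_add_sub_sum_range_le hu N j).trans ?_
    have : (j : ℝ) ≤ K := by exact_mod_cast (Finset.mem_range.1 hj).le
    gcongr
  · simp

section WeakMixing

variable {Ω : Type*} [MeasurableSpace Ω] {T : Ω → Ω} {μ : Measure Ω}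

/-- Unimodular eigenfunctions of a weak mixing transformation are constant. -/
theorem WeakMixing.ae_eq_const_of_eigenfunction [IsProbabilityMeasure μ] (hwm : WeakMixing T μ)
    {z : ℂ} (hz : ‖z‖ = 1) {f : Ω → ℂ}
    (hf : AEStronglyMeasurable f μ) (hfT : ∀ᵐ ω ∂μ, z * f (T ω) = f ω) :
    ∃ c : ℂ, ∀ᵐ ω ∂μ, f ω = c := by
  have hzz : z * starRingEnd ℂ z = 1 := by
    rw [Complex.mul_conj, Complex.normSq_eq_norm_sq, hz]; simp
  have h1 : AEStronglyMeasurable (fun p : Ω × Ω => f p.1 * starRingEnd ℂ (f p.2)) (μ.prod μ) :=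
    hf.comp_fst.mul (Complex.continuous_conj.comp_aestronglyMeasurable hf.comp_snd)
  have hfst := Measure.quasiMeasurePreserving_fst (μ := μ) (ν := μ) |>.ae hfT
  have hsnd := Measure.quasiMeasurePreserving_snd (μ := μ) (ν := μ) |>.ae hfT
  obtain ⟨c, hc⟩ := Ergodic.ae_eq_const_of_ae_eq_comp_ae hwm h1 (by
    filter_upwards [hfst, hsnd] with p h1 h2
    simp only [Function.comp_apply, Prod.map_fst, Prod.map_snd]
    rw [← h1, ← h2, map_mul]
    linear_combination (-(f (T p.1) * starRingEnd ℂ (f (T p.2)))) * hzz)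
  by_cases h0 : ∀ᵐ ω ∂μ, f ω = 0
  · exact ⟨0, h0⟩
  obtain ⟨x, hx0, hx⟩ := ((not_eventually.1 h0).and_eventually (Measure.ae_ae_of_ae_prod hc)).exists
  refine ⟨starRingEnd ℂ (c / f x), ?_⟩
  filter_upwards [hx] with y hy
  simp only [Function.const_apply] at hy
  rw [← hy, mul_div_cancel_left₀ _ hx0, Complex.conj_conj]

/-- The mean ergodic theorem for twisted averages of a centered function. -/
theorem WeakMixing.tendsto_integral_norm_twisted_average [IsProbabilityMeasure μ]
    (hwm : WeakMixing T μ)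
    (hT : MeasurePreserving T μ μ) {z : ℂ} (hz : ‖z‖ = 1) {f : Ω → ℂ}
    (hf : MemLp f 2 μ) (hf0 : ∫ ω, f ω ∂μ = 0) :
    Tendsto (fun N : ℕ => ∫ ω, ‖(N : ℂ)⁻¹ * ∑ n ∈ Finset.range N, z ^ n * f (T^[n] ω)‖ ∂μ)
      atTop (𝓝 0) := by
  set U : Lp ℂ 2 μ →L[ℂ] Lp ℂ 2 μ :=
    z • (Lp.compMeasurePreservingₗᵢ ℂ T hT).toContinuousLinearMap with hU
  have hUapp (g : Lp ℂ 2 μ) : U g = z • Lp.compMeasurePreserving T hT g := rfl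
  have hU1 : ‖U‖ ≤ 1 := U.opNorm_le_bound zero_le_one fun g => by
    rw [hUapp, norm_smul, hz, Lp.norm_compMeasurePreserving]
  have hiter (n : ℕ) : ∀ g : Lp ℂ 2 μ, U^[n] g =ᵐ[μ] fun ω => z ^ n * g (T^[n] ω) := by
    induction n with
    | zero => intro g; simp
    | succ n ih =>
      intro g
      rw [Function.iterate_succ_apply']
      have h1 := Lp.coeFn_compMeasurePreserving (U^[n] g) hT
      have h2 := Lp.coeFn_smul z (Lp.compMeasurePreserving T hT (U^[n] g))
      have h3 := hT.quasiMeasurePreserving.ae (ih g)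
      rw [hUapp]
      filter_upwards [h1, h2, h3] with ω h1 h2 h3
      rw [h2, Pi.smul_apply, h1, Function.comp_apply, h3, smul_eq_mul, pow_succ', mul_assoc,
        Function.iterate_succ_apply]
  have hlim := U.tendsto_birkhoffAverage_orthogonalProjection hU1 (hf.toLp f)
  have hproj : (U.eqLocus (1 : Lp ℂ 2 μ →L[ℂ] Lp ℂ 2 μ)).orthogonalProjectionOnto (hf.toLp f)
      = 0 := by
    rw [Submodule.orthogonalProjectionOnto_eq_zero_iff, Submodule.mem_orthogonal]
    intro g hg
    have hg' : U g = g := hg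
    have h1 := hiter 1 g
    rw [Function.iterate_one, hg'] at h1
    obtain ⟨c, hc⟩ := hwm.ae_eq_const_of_eigenfunction hz (Lp.aestronglyMeasurable g) (by
      filter_upwards [h1] with ω hω
      rw [hω]; simp)
    rw [L2.inner_def]
    have : (fun ω => inner ℂ (g ω) (hf.toLp f ω)) =ᵐ[μ] fun ω => f ω * starRingEnd ℂ c := by
      filter_upwards [hc, hf.coeFn_toLp] with ω h1 h2
      rw [h1, h2]; simp
    rw [integral_congr_ae this, integral_mul_const, hf0, zero_mul]
  rw [hproj, Submodule.coe_zero, tendsto_zero_iff_norm_tendsto_zero] at hlim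
  refine squeeze_zero (fun N => integral_nonneg fun ω => norm_nonneg _) (fun N => ?_) hlim
  set A := birkhoffAverage ℂ U _root_.id N (hf.toLp f) with hA
  have hAe : A =ᵐ[μ] fun ω => (N : ℂ)⁻¹ * ∑ n ∈ Finset.range N, z ^ n * f (T^[n] ω) := by
    have h1 := Lp.coeFn_smul ((N : ℂ)⁻¹) (∑ n ∈ Finset.range N, U^[n] (hf.toLp f))
    have h2 := Lp.coeFn_finsetSum (Finset.range N) (fun n => U^[n] (hf.toLp f))
    have h3 := ae_all_iff.2 fun n => hiter n (hf.toLp f)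
    have h4 := ae_all_iff.2 fun n => (hT.iterate n).quasiMeasurePreserving.ae hf.coeFn_toLp
    have hA' : A = (N : ℂ)⁻¹ • ∑ n ∈ Finset.range N, U^[n] (hf.toLp f) := rfl
    rw [hA']
    filter_upwards [h1, h2, h3, h4] with ω h1 h2 h3 h4
    rw [h1, Pi.smul_apply, h2, smul_eq_mul]
    simp [h3, h4]
  have hAm : MemLp A 2 μ := Lp.memLp A
  have h1 : ∫ ω, ‖(N : ℂ)⁻¹ * ∑ n ∈ Finset.range N, z ^ n * f (T^[n] ω)‖ ∂μ = ∫ ω, ‖A ω‖ ∂μ :=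
    integral_congr_ae (by filter_upwards [hAe] with ω h; rw [h])
  rw [h1, integral_norm_eq_lintegral_enorm hAm.1, ← eLpNorm_one_eq_lintegral_enorm, Lp.norm_def]
  exact ENNReal.toReal_mono (Lp.eLpNorm_ne_top A)
    (eLpNorm_le_eLpNorm_of_exponent_le (by norm_num) hAm.1)

/-- The twisted pointwise ergodic theorem for a bounded centered function. -/
theorem WeakMixing.ae_tendsto_twisted_average [IsProbabilityMeasure μ] (hwm : WeakMixing T μ)
    (hT : MeasurePreserving T μ μ) {z : ℂ} (hz : ‖z‖ = 1) {f : Ω → ℂ} (hf : Measurable f)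
    {C : ℝ} (hC : ∀ ω, ‖f ω‖ ≤ C) (hf0 : ∫ ω, f ω ∂μ = 0) :
    ∀ᵐ ω ∂μ, Tendsto (fun N : ℕ => (N : ℂ)⁻¹ * ∑ n ∈ Finset.range N, z ^ n * f (T^[n] ω))
      atTop (𝓝 0) := by
  set A : ℕ → Ω → ℂ := fun N ω => (N : ℂ)⁻¹ * ∑ n ∈ Finset.range N, z ^ n * f (T^[n] ω) with hA
  have hAm (N : ℕ) : Measurable (A N) := by
    refine (Finset.measurable_fun_sum _ fun n _ => ?_).const_mul _
    exact (hf.comp (hT.measurable.iterate n)).const_mul _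
  have hu (ω : Ω) (n : ℕ) : ‖z ^ n * f (T^[n] ω)‖ ≤ C := by
    rw [norm_mul, norm_pow, hz, one_pow, one_mul]; exact hC _
  have hAi (N : ℕ) : Integrable (A N) μ := by
    refine (integrable_finsetSum _ fun n _ => ?_).const_mul _
    refine Integrable.of_bound (C := C) ?_ (Eventually.of_forall fun ω => hu ω n)
    exact ((hf.comp (hT.measurable.iterate n)).const_mul _).aestronglyMeasurable
  have hlim := hwm.tendsto_integral_norm_twisted_average hT hz
    (MemLp.of_bound hf.aestronglyMeasurable C (Eventually.of_forall hC)) hf0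
  have hgood (ε : ℝ) (hε : 0 < ε) (K : ℕ) (hK : 0 < K) (ω : Ω)
      (hω : ∀ N : ℕ, birkhoffSum T (fun ω => ‖A K ω‖) N ω ≤ N * ε) :
      ∀ᶠ N in atTop, ‖A N ω‖ ≤ 2 * ε := by
    have hev := (tendsto_natCast_atTop_atTop (R := ℝ)).eventually_ge_atTop (2 * K * C / ε)
    filter_upwards [hev, eventually_gt_atTop 0] with N hN hN0
    have h1 := norm_sum_range_sub_sum_window_le (hu ω) hK N
    have h2 : ‖∑ n ∈ Finset.range N, (K : ℂ)⁻¹ * ∑ j ∈ Finset.range K,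
        z ^ (n + j) * f (T^[n + j] ω)‖ ≤ N * ε := by
      refine (norm_sum_le _ _).trans ((Finset.sum_le_sum fun n _ => ?_).trans (hω N))
      have : (K : ℂ)⁻¹ * ∑ j ∈ Finset.range K, z ^ (n + j) * f (T^[n + j] ω)
          = z ^ n * A K (T^[n] ω) := by
        simp only [hA, Finset.mul_sum, ← Function.iterate_add_apply]
        refine Finset.sum_congr rfl fun j _ => ?_
        rw [add_comm j n]; ring
      rw [this, norm_mul, norm_pow, hz, one_pow, one_mul]
    have h3 : ‖∑ n ∈ Finset.range N, z ^ n * f (T^[n] ω)‖ ≤ N * ε + 2 * K * C :=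
      (norm_le_norm_add_norm_sub' _ _).trans (add_le_add h2 (by rwa [norm_sub_rev]))
    rw [div_le_iff₀ hε] at hN
    rw [hA]
    simp only
    rw [norm_mul, norm_inv, Complex.norm_natCast, inv_mul_le_iff₀ (by exact_mod_cast hN0)]
    linarith
  have hbad (ε : ℝ) (hε : 0 < ε) : ∀ᵐ ω ∂μ, ∀ᶠ N in atTop, ‖A N ω‖ ≤ 2 * ε := by
    rw [ae_iff, ← measureReal_eq_zero_iff]
    refine le_antisymm (ge_of_tendsto' (x := atTop)
      (((hlim.comp (tendsto_add_atTop_nat 1)).const_mul ε⁻¹).trans (by simp)) fun K => ?_)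
      measureReal_nonneg
    rw [Function.comp_apply, le_inv_mul_iff₀ hε]
    refine (mul_le_mul_of_nonneg_left (measureReal_mono fun ω hω => ?_) hε.le).trans
      (mul_measureReal_exists_lt_birkhoffSum_le hT (hAm (K + 1)).norm (hAi (K + 1)).norm
        (fun ω => norm_nonneg _) hε.le)
    by_contra hcon
    simp only [Set.mem_ofPred_eq, not_exists, not_lt] at hcon
    exact hω (hgood ε hε (K + 1) K.succ_pos ω hcon)
  filter_upwards [ae_all_iff.2 fun m : ℕ => hbad (1 / (m + 1)) (by positivity)] with ω hω
  rw [Metric.tendsto_nhds]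
  intro ε hε
  obtain ⟨m, hm⟩ := exists_nat_one_div_lt (half_pos hε)
  filter_upwards [hω m] with N hN
  rw [dist_zero_right]
  linarith

end WeakMixing

section Equidistribution

/-- Weyl's criterion with bounded weights: averages along `n • θ + s` of continuous functions
on the circle are determined by the averages of the characters along `n • θ`. -/
theorem AddCircle.tendsto_weighted_average {p : ℝ} [Fact (0 < p)] {c : ℕ → ℂ} {C : ℝ}
    (hc : ∀ n, ‖c n‖ ≤ C) (θ s : AddCircle p) {L : ℂ}
    (h : ∀ m : ℤ, Tendsto (fun N : ℕ => (N : ℂ)⁻¹ * ∑ n ∈ Finset.range N, fourier m θ ^ n * c n)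
      atTop (𝓝 (if m = 0 then L else 0))) (φ : C(AddCircle p, ℂ)) :
    Tendsto (fun N : ℕ => (N : ℂ)⁻¹ * ∑ n ∈ Finset.range N, φ (n • θ + s) * c n)
      atTop (𝓝 (L * ∫ x, φ x ∂AddCircle.haarAddCircle)) := by
  have hint (ψ : C(AddCircle p, ℂ)) : Integrable ψ AddCircle.haarAddCircle :=
    ψ.continuous.integrable_of_hasCompactSupport (HasCompactSupport.of_compactSpace _)
  have hC : 0 ≤ C := (norm_nonneg _).trans (hc 0)
  have hpow (m : ℤ) (n : ℕ) : fourier m (n • θ + s) = fourier m θ ^ n * fourier m s := by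
    rw [fourier_apply, smul_add, AddCircle.toCircle_add, smul_comm, AddCircle.toCircle_nsmul]
    simp [fourier_apply]
  -- the statement holds on the span of the characters
  have hspan : ∀ ψ ∈ Submodule.span ℂ (Set.range (@fourier p)),
      Tendsto (fun N : ℕ => (N : ℂ)⁻¹ * ∑ n ∈ Finset.range N, ψ (n • θ + s) * c n)
      atTop (𝓝 (L * ∫ x, ψ x ∂AddCircle.haarAddCircle)) := by
    intro ψ hψ
    induction hψ using Submodule.span_induction with
    | mem ψ hψ =>
      obtain ⟨m, rfl⟩ := hψ
      have h1 : ∫ x : AddCircle p, fourier m x ∂AddCircle.haarAddCircle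
          = if m = 0 then 1 else 0 := by
        have := congr_fun (fourierCoeff_fourier (T := p) m) 0
        simpa [fourierCoeff, Pi.single_apply, eq_comm] using this
      rw [h1]
      have h2 := (h m).const_mul (fourier m s)
      have h3 : fourier m s * (if m = 0 then L else 0) = L * (if m = 0 then 1 else 0) := by
        split_ifs with hm
        · subst hm; simp
        · simp
      rw [h3] at h2
      refine h2.congr fun N => ?_
      simp only [hpow, Finset.mul_sum]
      exact Finset.sum_congr rfl fun n _ => by ring
    | zero => simp
    | add ψ₁ ψ₂ _ _ h1 h2 =>
      have h3 := h1.add h2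
      rw [← mul_add, ← integral_add (hint ψ₁) (hint ψ₂)] at h3
      refine h3.congr fun N => ?_
      rw [← mul_add, ← Finset.sum_add_distrib]
      simp [add_mul]
    | smul a ψ _ h1 =>
      have h2 := h1.const_mul a
      rw [mul_left_comm, ← integral_const_mul] at h2
      refine h2.congr fun N => ?_
      rw [mul_left_comm, Finset.mul_sum]
      simp [mul_assoc]
  have hdense : φ ∈ closure (Submodule.span ℂ (Set.range (@fourier p)) : Set C(AddCircle p, ℂ)) := by
    rw [← Submodule.topologicalClosure_coe, span_fourier_closure_eq_top]
    trivial
  rw [Metric.tendsto_atTop]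
  intro ε hε
  have hden : 0 < C + ‖L‖ + 1 := by positivity
  obtain ⟨ψ, hψ, hφψ⟩ := Metric.mem_closure_iff.1 hdense (ε / (2 * (C + ‖L‖ + 1))) (by positivity)
  obtain ⟨N₀, hN₀⟩ := Metric.tendsto_atTop.1 (hspan ψ hψ) (ε / 2) (half_pos hε)
  refine ⟨N₀ + 1, fun N hN => ?_⟩
  have hN0 : (0 : ℝ) < N := by exact_mod_cast (by omega : 0 < N)
  set δ := dist φ ψ with hδ
  have hδ0 : 0 ≤ δ := dist_nonneg
  have hpt (x : AddCircle p) : ‖φ x - ψ x‖ ≤ δ := by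
    rw [← dist_eq_norm]; exact ContinuousMap.dist_apply_le_dist x
  have h1 : ‖(N : ℂ)⁻¹ * ∑ n ∈ Finset.range N, φ (n • θ + s) * c n
      - (N : ℂ)⁻¹ * ∑ n ∈ Finset.range N, ψ (n • θ + s) * c n‖ ≤ δ * C := by
    rw [← mul_sub, ← Finset.sum_sub_distrib, norm_mul, norm_inv, Complex.norm_natCast,
      inv_mul_le_iff₀ hN0]
    refine (norm_sum_le_of_le _ (n := fun _ => δ * C) fun n _ => ?_).trans (by simp)
    rw [← sub_mul, norm_mul]
    exact mul_le_mul (hpt _) (hc n) (norm_nonneg _) hδ0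
  have h2 : ‖L * ∫ x, ψ x ∂AddCircle.haarAddCircle - L * ∫ x, φ x ∂AddCircle.haarAddCircle‖
      ≤ ‖L‖ * δ := by
    rw [← mul_sub, ← integral_sub (hint ψ) (hint φ), norm_mul]
    gcongr
    refine (norm_integral_le_of_norm_le_const (C := δ) (Eventually.of_forall fun x => ?_)).trans
      (by simp)
    rw [norm_sub_rev]; exact hpt x
  have h3 := hN₀ N (by omega)
  have h4 : δ * (C + ‖L‖) ≤ ε / 2 := by
    rw [lt_div_iff₀ (by positivity)] at hφψ
    nlinarith
  refine (dist_triangle4 _ ((N : ℂ)⁻¹ * ∑ n ∈ Finset.range N, ψ (n • θ + s) * c n)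
    (L * ∫ x, ψ x ∂AddCircle.haarAddCircle) _).trans_lt ?_
  rw [dist_eq_norm, dist_eq_norm (L * _)]
  linarith

/-- Averages of powers of a unimodular number different from `1` tend to `0`. -/
lemma tendsto_average_pow {z : ℂ} (hz : ‖z‖ = 1) (hz1 : z ≠ 1) :
    Tendsto (fun N : ℕ => (N : ℂ)⁻¹ * ∑ n ∈ Finset.range N, z ^ n) atTop (𝓝 0) := by
  have h0 : 0 < ‖z - 1‖ := norm_pos_iff.2 (sub_ne_zero.2 hz1)
  refine squeeze_zero_norm (a := fun N : ℕ => (N : ℝ)⁻¹ * (2 / ‖z - 1‖)) (fun N => ?_) ?_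
  · rw [geom_sum_eq hz1, norm_mul, norm_div, norm_inv, Complex.norm_natCast]
    gcongr
    refine (norm_sub_le _ _).trans ?_
    rw [norm_pow, hz]; norm_num
  · simpa using (tendsto_inv_atTop_nhds_zero_nat (𝕜 := ℝ)).mul_const (2 / ‖z - 1‖)

/-- **Weyl's equidistribution theorem**, tested against a continuous function on `[0, 1]` with
equal values at the endpoints. -/
theorem Irrational.tendsto_average_fract {α : ℝ} (hα : Irrational α) (t : ℝ) {φ : ℝ → ℝ}
    (hφ : Continuous φ) (h01 : φ 0 = φ 1) :
    Tendsto (fun N : ℕ => (N : ℝ)⁻¹ * ∑ k ∈ Finset.Icc 1 N, φ (Int.fract (t + k * α)))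
      atTop (𝓝 (∫ x in (0 : ℝ)..1, φ x)) := by
  set Φ : C(AddCircle (1 : ℝ), ℂ) := ⟨AddCircle.liftIco 1 0 fun x => (φ x : ℂ),
    AddCircle.liftIco_zero_continuous (by simp [h01]) (by fun_prop)⟩ with hΦ
  have hΦc (x : ℝ) : Φ (x : AddCircle (1 : ℝ)) = φ (Int.fract x) := by
    have h1 : (x : AddCircle (1 : ℝ)) = (Int.fract x : ℝ) := by
      rw [← sub_eq_zero, ← AddCircle.coe_sub, AddCircle.coe_eq_zero_iff]
      exact ⟨⌊x⌋, by rw [Int.self_sub_fract]; simp⟩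
    rw [h1]
    exact AddCircle.liftIco_zero_coe_apply (f := fun x => (φ x : ℂ))
      ⟨Int.fract_nonneg x, Int.fract_lt_one x⟩
  have hint : ∫ x, Φ x ∂AddCircle.haarAddCircle = ((∫ x in (0 : ℝ)..1, φ x : ℝ) : ℂ) := by
    rw [AddCircle.integral_haarAddCircle, ← AddCircle.intervalIntegral_preimage 1 0,
      inv_one, one_smul, zero_add, ← intervalIntegral.integral_ofReal,
      intervalIntegral.integral_of_le zero_le_one, intervalIntegral.integral_of_le zero_le_one,
      ← integral_Ico_eq_integral_Ioc, ← integral_Ico_eq_integral_Ioc]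
    refine setIntegral_congr_fun measurableSet_Ico fun x hx => ?_
    rw [hΦc, Int.fract_eq_self.2 hx]
  have hlim := AddCircle.tendsto_weighted_average (p := 1) (c := fun _ => 1) (C := 1) (by simp)
    (α : AddCircle (1 : ℝ)) ((t + α : ℝ) : AddCircle (1 : ℝ)) (L := 1) (fun m => by
      simp only [mul_one]
      split_ifs with hm
      · subst hm
        simp only [fourier_zero, one_pow, Finset.sum_const, Finset.card_range, nsmul_eq_mul,
          mul_one]
        refine tendsto_const_nhds.congr' ?_
        filter_upwards [eventually_ne_atTop 0] with N hN
        rw [inv_mul_cancel₀ (by exact_mod_cast hN)]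
      · refine tendsto_average_pow (by rw [fourier_apply]; exact Circle.norm_coe _) fun h1 => ?_
        rw [fourier_coe_apply, Complex.exp_eq_one_iff] at h1
        obtain ⟨k, hk⟩ := h1
        have h2 : (m * α : ℂ) = k := by
          have := Complex.two_pi_I_ne_zero
          apply mul_left_cancel₀ this
          rw [mul_comm (2 * Real.pi * Complex.I) (k : ℂ), ← hk]
          push_cast; ring
        have h3 : (m : ℝ) * α = k := by exact_mod_cast h2
        exact (hα.intCast_mul hm).ne_int k h3) Φ
  rw [hint, one_mul] at hlim
  have hre := (Complex.continuous_re.tendsto _).comp hlim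
  rw [Complex.ofReal_re] at hre
  refine hre.congr fun N => ?_
  rw [← Finset.Ico_add_one_right_eq_Icc, Finset.sum_Ico_eq_sum_range, Nat.add_sub_cancel]
  have h1 (n : ℕ) : Φ (n • (α : AddCircle (1 : ℝ)) + ((t + α : ℝ) : AddCircle (1 : ℝ)))
      = φ (Int.fract (t + (1 + n : ℕ) * α)) := by
    rw [← AddCircle.coe_nsmul, ← AddCircle.coe_add, hΦc]
    congr 3
    rw [nsmul_eq_mul]; push_cast; ring
  simp only [Function.comp_apply, mul_one, h1]
  rw [← Complex.ofReal_sum, ← Complex.ofReal_natCast, ← Complex.ofReal_inv, ← Complex.ofReal_mul,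
    Complex.ofReal_re]

end Equidistribution

/-- The `α`-periodization of a function on `ℝ`. -/
noncomputable def periodization (α : ℝ) (φ : ℝ → ℝ) (x : ℝ) : ℝ := ∑ᶠ k : ℤ, φ (x + k * α)

section periodization

variable {α : ℝ} {φ : ℝ → ℝ}

lemma finite_setOf_add_mul_mem_Ioo (hα : 0 < α) (a b c : ℝ) :
    {k : ℤ | c + k * α ∈ Set.Ioo a b}.Finite := by
  refine (Set.finite_Icc ⌊(a - c) / α⌋ ⌈(b - c) / α⌉).subset fun k hk => ⟨?_, ?_⟩
  · refine Int.cast_le (R := ℝ).1 ((Int.floor_le _).trans ?_)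
    rw [div_le_iff₀ hα]; linarith [hk.1]
  · refine Int.cast_le (R := ℝ).1 (le_trans ?_ (Int.le_ceil _))
    rw [le_div_iff₀ hα]; linarith [hk.2]

lemma finite_support_comp_add_mul (hα : 0 < α) (h0 : ∀ x ∉ Set.Ioo (0 : ℝ) 1, φ x = 0) (x : ℝ) :
    (Function.support fun k : ℤ => φ (x + k * α)).Finite :=
  (finite_setOf_add_mul_mem_Ioo hα 0 1 x).subset fun k hk => by
    by_contra hcon
    exact hk (h0 _ hcon)

lemma continuous_periodization (hα : 0 < α) (hφ : Continuous φ)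
    (h0 : ∀ x ∉ Set.Ioo (0 : ℝ) 1, φ x = 0) : Continuous (periodization α φ) := by
  refine continuous_finsum (f := fun (k : ℤ) x => φ (x + k * α)) (fun k => by fun_prop) fun x => ?_
  refine ⟨Set.Ioo (x - 1) (x + 1), Ioo_mem_nhds (by linarith) (by linarith), ?_⟩
  refine (finite_setOf_add_mul_mem_Ioo hα (-1) 2 x).subset ?_
  rintro k ⟨y, hy, hy1, hy2⟩
  have h1 : y + k * α ∈ Set.Ioo (0 : ℝ) 1 := by
    by_contra hcon
    exact hy (h0 _ hcon)
  constructor <;> linarith [h1.1, h1.2]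

lemma periodic_periodization : Function.Periodic (periodization α φ) α := fun x => by
  refine finsum_eq_of_bijective (fun k : ℤ => k + 1) (Equiv.addRight (1 : ℤ)).bijective fun k => ?_
  congr 1; push_cast; ring

lemma sum_le_periodization (hα : 0 < α) (h0 : ∀ x ∉ Set.Ioo (0 : ℝ) 1, φ x = 0)
    (hpos : ∀ x, 0 ≤ φ x) (s : Finset ℤ) (x : ℝ) :
    ∑ k ∈ s, φ (x + k * α) ≤ periodization α φ x := by
  have hfin := finite_support_comp_add_mul hα h0 x
  have hsum : Summable fun k : ℤ => φ (x + k * α) := summable_of_hasFiniteSupport hfin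
  rw [periodization, ← tsum_eq_finsum (L := .unconditional ℤ) hfin]
  exact hsum.sum_le_tsum s fun k _ => hpos _

/-- Along the orbit `t + k * α`, sums grouped by the integer part are, up to boundary terms,
sums of the periodization. -/
lemma abs_sum_fract_mul_sub_sum_periodization_le (hα : 0 < α)
    (h0 : ∀ x ∉ Set.Ioo (0 : ℝ) 1, φ x = 0) (hpos : ∀ x, 0 ≤ φ x) {B C : ℝ}
    (hB : ∀ x, periodization α φ x ≤ B) {b : ℕ → ℝ} (hb : ∀ n, |b n| ≤ C)
    {t : ℝ} (ht : t ∈ Set.Ico (0 : ℝ) 1) (N : ℕ) :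
    |∑ k ∈ Finset.Icc 1 N, φ (Int.fract (t + k * α)) * b (lk α t k)
      - ∑ n ∈ Finset.range (lk α t N), periodization α φ (t - n) * b n| ≤ 2 * (B * C) := by
  set M := lk α t N with hM
  have hC : 0 ≤ C := (abs_nonneg _).trans (hb 0)
  have hlk (k : ℕ) : ((lk α t k : ℕ) : ℝ) = ⌊t + k * α⌋ := by
    have h1 : 0 ≤ ⌊t + α * k⌋ := Int.floor_nonneg.2 (by have := ht.1; positivity)
    rw [lk, mul_comm (k : ℝ) α]
    exact_mod_cast congrArg (Int.cast (R := ℝ)) (Int.toNat_of_nonneg h1)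
  set P : ℕ → ℝ := fun n => ∑ k ∈ Finset.Icc 1 N, φ (t - n + k * α) with hP
  have hPs (n : ℕ) : P n = ∑ k ∈ (Finset.Icc 1 N).map Nat.castEmbedding,
      φ (t - n + (k : ℤ) * α) := by
    simp [hP, Finset.sum_map]
  have hP0 (n : ℕ) : 0 ≤ P n := Finset.sum_nonneg fun k _ => hpos _
  have hPle (n : ℕ) : P n ≤ periodization α φ (t - n) := by
    rw [hPs]; exact sum_le_periodization hα h0 hpos _ _
  have hPeq (n : ℕ) (hn0 : 0 < n) (hnM : n < M) : P n = periodization α φ (t - n) := by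
    rw [hPs, periodization]
    refine (finsum_eq_sum_of_support_subset _ fun k hk => ?_).symm
    have hk1 : t - n + k * α ∈ Set.Ioo (0 : ℝ) 1 := by
      by_contra hcon
      exact hk (h0 _ hcon)
    have hn1 : (1 : ℝ) ≤ n := by exact_mod_cast hn0
    have hMle : (n : ℝ) + 1 ≤ t + N * α :=
      le_trans (by rw [← hlk N]; exact_mod_cast hnM) (Int.floor_le _)
    have hk0 : 0 < k := by
      have : 0 < (k : ℝ) * α := by linarith [hk1.1, ht.2]
      exact_mod_cast pos_of_mul_pos_left this hα.le
    have hkN : k < N := by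
      have : (k : ℝ) * α < N * α := by linarith [hk1.2]
      exact_mod_cast lt_of_mul_lt_mul_right this hα.le
    simp only [Finset.coe_map, Set.mem_image, Finset.coe_Icc, Set.mem_Icc, Nat.castEmbedding_apply]
    exact ⟨k.toNat, by omega, by omega⟩
  have hterm (k : ℕ) (hk : k ∈ Finset.Icc 1 N) : φ (Int.fract (t + k * α)) * b (lk α t k)
      = ∑ n ∈ Finset.range (M + 1), φ (t - n + k * α) * b n := by
    have hkM : lk α t k ≤ M := by
      refine Int.toNat_le_toNat (Int.floor_le_floor ?_)
      have : (k : ℝ) ≤ N := by exact_mod_cast (Finset.mem_Icc.1 hk).2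
      gcongr
    rw [Finset.sum_eq_single_of_mem (lk α t k) (Finset.mem_range.2 (by omega))]
    · rw [hlk, Int.fract]; congr 2; ring
    · intro n _ hn
      rw [h0, zero_mul]
      rintro ⟨h1, h2⟩
      have : ⌊t + k * α⌋ = (n : ℤ) := Int.floor_eq_iff.2 ⟨by push_cast; linarith, by
        push_cast; linarith⟩
      have h3 := hlk k
      rw [this] at h3
      exact hn (by exact_mod_cast h3.symm)
  have hsum : ∑ k ∈ Finset.Icc 1 N, φ (Int.fract (t + k * α)) * b (lk α t k)
      = ∑ n ∈ Finset.range (M + 1), P n * b n := by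
    rw [Finset.sum_congr rfl hterm, Finset.sum_comm]
    simp only [hP, Finset.sum_mul]
  have hdiff : ∑ n ∈ Finset.range (M + 1), P n * b n
      - ∑ n ∈ Finset.range M, periodization α φ (t - n) * b n
      = P M * b M + ∑ n ∈ Finset.range M, (P n - periodization α φ (t - n)) * b n := by
    rw [Finset.sum_range_succ]
    simp only [sub_mul, Finset.sum_sub_distrib]
    ring
  have hB0 : 0 ≤ B := ((hP0 0).trans (hPle 0)).trans (hB _)
  rw [hsum, hdiff, two_mul]
  refine (abs_add_le _ _).trans (add_le_add ?_ ?_)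
  · rw [abs_mul, abs_of_nonneg (hP0 M)]
    exact mul_le_mul ((hPle M).trans (hB _)) (hb M) (abs_nonneg _) hB0
  · refine (Finset.abs_sum_le_sum_abs _ _).trans ((Finset.sum_le_sum
      (g := fun n : ℕ => if n = 0 then B * C else 0) fun n hn => ?_).trans ?_)
    · rw [abs_mul]
      split_ifs with hn0
      · refine mul_le_mul ?_ (hb n) (abs_nonneg _) hB0
        rw [abs_sub_comm, abs_of_nonneg (sub_nonneg.2 (hPle n))]
        linarith [hB (t - n), hP0 n]
      · rw [hPeq n (Nat.pos_of_ne_zero hn0) (Finset.mem_range.1 hn)]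
        simp
    · rw [Finset.sum_ite_eq']
      split_ifs
      · exact le_rfl
      · positivity

/-- If the averages of `b` twisted by the characters of period `α` vanish, then so do the averages
of `φ ({t + kα}) b (⌊t + kα⌋)` for continuous `φ ≥ 0` supported in `(0, 1)`. -/
theorem tendsto_average_fract_mul_of_twisted [Fact (0 < α)] (hα1 : α < 1) (hφ : Continuous φ)
    (h0 : ∀ x ∉ Set.Ioo (0 : ℝ) 1, φ x = 0) (hpos : ∀ x, 0 ≤ φ x) {C : ℝ}
    {b : ℕ → ℝ} (hb : ∀ n, |b n| ≤ C)
    (h : ∀ m : ℤ, Tendsto (fun N : ℕ => (N : ℂ)⁻¹ * ∑ n ∈ Finset.range N,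
      fourier m ((-1 : ℝ) : AddCircle α) ^ n * (b n : ℂ)) atTop (𝓝 0))
    {t : ℝ} (ht : t ∈ Set.Ico (0 : ℝ) 1) :
    Tendsto (fun N : ℕ => (N : ℝ)⁻¹ * ∑ k ∈ Finset.Icc 1 N,
      φ (Int.fract (t + k * α)) * b (lk α t k)) atTop (𝓝 0) := by
  have hα : 0 < α := Fact.out
  have hper : Function.Periodic (fun x => (periodization α φ x : ℂ)) α := fun x => by
    simp only [periodic_periodization (φ := φ) x]
  set Φ : C(AddCircle α, ℂ) := ⟨hper.lift, continuous_coinduced_dom.2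
    (Complex.continuous_ofReal.comp (continuous_periodization hα hφ h0))⟩ with hΦ
  have hΦc (x : ℝ) : Φ (x : AddCircle α) = periodization α φ x := rfl
  have hB (x : ℝ) : periodization α φ x ≤ ‖Φ‖ := by
    have h1 := Φ.norm_coe_le_norm (x : AddCircle α)
    rw [hΦc, Complex.norm_real] at h1
    exact (le_abs_self _).trans h1
  have hlim := AddCircle.tendsto_weighted_average (c := fun n => (b n : ℂ)) (C := C)
    (fun n => by rw [Complex.norm_real]; exact hb n) ((-1 : ℝ) : AddCircle α) (t : AddCircle α)
    (L := 0) (fun m => by simpa using h m) Φ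
  rw [zero_mul] at hlim
  have hlim' : Tendsto (fun N : ℕ => (N : ℝ)⁻¹ *
      ∑ n ∈ Finset.range N, periodization α φ (t - n) * b n) atTop (𝓝 0) := by
    have hre := (Complex.continuous_re.tendsto _).comp hlim
    refine hre.congr fun N => ?_
    have h1 (n : ℕ) : Φ (n • ((-1 : ℝ) : AddCircle α) + (t : AddCircle α))
        = periodization α φ (t - n) := by
      rw [← AddCircle.coe_nsmul, ← AddCircle.coe_add, hΦc]
      congr 2
      rw [nsmul_eq_mul]; ring
    simp only [Function.comp_apply, h1]
    rw [← Complex.ofReal_natCast, ← Complex.ofReal_inv]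
    simp only [← Complex.ofReal_mul, ← Complex.ofReal_sum, Complex.ofReal_re]
  have hM : Tendsto (lk α t) atTop atTop := by
    refine tendsto_atTop.2 fun K => ?_
    filter_upwards [(tendsto_natCast_atTop_atTop (R := ℝ)).eventually_ge_atTop (K / α)] with N hN
    rw [div_le_iff₀ hα] at hN
    have h1 : (K : ℤ) ≤ ⌊t + α * N⌋ := Int.le_floor.2 (by push_cast; linarith [ht.1])
    rw [lk]; omega
  have hlimM := (hlim'.comp hM).norm.const_mul 2
  have hinv := (tendsto_inv_atTop_nhds_zero_nat (𝕜 := ℝ)).mul_const (2 * (‖Φ‖ * C))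
  have hbound := hinv.add hlimM
  simp only [zero_mul, norm_zero, mul_zero, add_zero] at hbound
  refine squeeze_zero_norm' ?_ hbound
  filter_upwards [eventually_gt_atTop 0] with N hN
  have hN1 : (1 : ℝ) ≤ N := by exact_mod_cast hN
  set S := ∑ k ∈ Finset.Icc 1 N, φ (Int.fract (t + k * α)) * b (lk α t k) with hS
  set R := ∑ n ∈ Finset.range (lk α t N), periodization α φ (t - n) * b n with hR
  have hSR : |S - R| ≤ 2 * (‖Φ‖ * C) :=
    abs_sum_fract_mul_sub_sum_periodization_le hα h0 hpos hB hb ht N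
  have hMN : ((lk α t N : ℕ) : ℝ) ≤ 2 * N := by
    have h1 : (⌊t + α * N⌋ : ℝ) ≤ 2 * N := (Int.floor_le _).trans (by nlinarith [ht.2])
    have h2 : ⌊t + α * N⌋ ≤ 2 * (N : ℤ) := by exact_mod_cast h1
    have h3 : lk α t N ≤ 2 * N := by rw [lk]; omega
    exact_mod_cast h3
  have hRle : |R| ≤ N * (2 * ‖((lk α t N : ℕ) : ℝ)⁻¹ * R‖) := by
    rcases Nat.eq_zero_or_pos (lk α t N) with hz | hz
    · have : R = 0 := by rw [hR, hz]; simp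
      rw [this]; simp
    · have hz' : (0 : ℝ) < (lk α t N : ℕ) := by exact_mod_cast hz
      rw [norm_mul, norm_inv, Real.norm_of_nonneg hz'.le, Real.norm_eq_abs]
      have h1 : |R| = (lk α t N : ℕ) * (((lk α t N : ℕ) : ℝ)⁻¹ * |R|) := by
        field_simp
      have h2 : 0 ≤ ((lk α t N : ℕ) : ℝ)⁻¹ * |R| := by positivity
      nlinarith
  rw [norm_mul, norm_inv, Real.norm_of_nonneg (by positivity : (0 : ℝ) ≤ N), Real.norm_eq_abs,
    inv_mul_le_iff₀ (by positivity), mul_add, mul_inv_cancel_left₀ (by positivity)]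
  have h1 : |S| ≤ |S - R| + |R| := by simpa using abs_add_le (S - R) R
  exact h1.trans (add_le_add hSR hRle)

end periodization

section Sandwich

/-- Inner approximation of an open subset of `(0, 1)` by continuous functions. -/
lemma exists_continuous_le_indicator_of_isOpen {U : Set ℝ} (hU : IsOpen U)
    (hU01 : U ⊆ Set.Ioo 0 1) {ε : ℝ} (hε : 0 < ε) :
    ∃ φ : ℝ → ℝ, Continuous φ ∧ (∀ x, 0 ≤ φ x) ∧ (∀ x, φ x ≤ 1) ∧ (∀ x ∉ U, φ x = 0) ∧
      volume.real U - ε < ∫ x in (0 : ℝ)..1, φ x ∧ ∫ x in (0 : ℝ)..1, φ x ≤ volume.real U := by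
  have hUfin : volume U ≠ ⊤ := measure_ne_top_of_subset hU01 (by simp)
  have hcompact : ∃ K ⊆ U, IsCompact K ∧ volume.real U - ε < volume.real K := by
    rcases lt_or_ge (volume.real U - ε) 0 with hneg | hnn
    · exact ⟨∅, Set.empty_subset _, isCompact_empty, by simpa using hneg⟩
    · obtain ⟨K, hKU, hK, hlt⟩ := hU.exists_lt_isCompact (μ := volume)
        (r := ENNReal.ofReal (volume.real U - ε)) (by
          rw [ENNReal.ofReal_lt_iff_lt_toReal hnn hUfin]
          exact sub_lt_self _ hε)
      refine ⟨K, hKU, hK, ?_⟩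
      rwa [ENNReal.ofReal_lt_iff_lt_toReal hnn (measure_ne_top_of_subset hKU hUfin)] at hlt
  obtain ⟨K, hKU, hK, hlt⟩ := hcompact
  obtain ⟨f, hf1, hf0, -, hf⟩ := exists_continuous_one_zero_of_isCompact hK hU.isClosed_compl
    (Set.disjoint_compl_right_iff_subset.2 hKU)
  have hf0' : ∀ x ∉ U, f x = 0 := fun x hx => hf0 hx
  have hint : ∫ x in (0 : ℝ)..1, f x = ∫ x, f x := by
    rw [intervalIntegral.integral_of_le zero_le_one]
    exact setIntegral_eq_integral_of_forall_compl_eq_zero fun x hx =>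
      hf0' x fun hxU => hx (Set.Ioo_subset_Ioc_self (hU01 hxU))
  have hind : ∀ x, f x ≤ U.indicator 1 x := fun x => by
    by_cases hx : x ∈ U
    · simpa [hx] using (hf x).2
    · simp [hx, hf0' x hx]
  have hUi : Integrable (U.indicator (1 : ℝ → ℝ)) :=
    (integrable_indicator_iff hU.measurableSet).2 (integrableOn_const hUfin)
  have hfi : Integrable f := hUi.mono' f.continuous.aestronglyMeasurable
    (Eventually.of_forall fun x => by rw [Real.norm_of_nonneg (hf x).1]; exact hind x)
  refine ⟨f, f.continuous, fun x => (hf x).1, fun x => (hf x).2, hf0', ?_, ?_⟩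
  · rw [hint]
    refine hlt.trans_le ?_
    rw [← integral_indicator_one hK.measurableSet]
    refine integral_mono ((integrable_indicator_iff hK.measurableSet).2
      (integrableOn_const hK.measure_lt_top.ne)) hfi fun x => ?_
    by_cases hx : x ∈ K
    · simp [hx, hf1 hx]
    · simpa [hx] using (hf x).1
  · rw [hint, ← integral_indicator_one hU.measurableSet]
    exact integral_mono hfi hUi hind

/-- Convergence of weighted averages against continuous test functions upgrades to indicators of
sets with null frontier. -/
theorem tendsto_average_indicator_of_null_frontier {I : Set ℝ} (hIm : MeasurableSet I)
    (hI01 : I ⊆ Set.Ico 0 1) (hfr : volume (frontier I) = 0) {x : ℕ → ℝ} {w : ℕ → ℝ} {C L : ℝ}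
    (hw : ∀ k, |w k| ≤ C)
    (h1 : ∀ φ : ℝ → ℝ, Continuous φ → (∀ y ∉ Set.Ioo (0 : ℝ) 1, φ y = 0) → (∀ y, 0 ≤ φ y) →
      Tendsto (fun N : ℕ => (N : ℝ)⁻¹ * ∑ k ∈ Finset.Icc 1 N, φ (x k)) atTop
        (𝓝 (∫ y in (0 : ℝ)..1, φ y)))
    (h2 : ∀ φ : ℝ → ℝ, Continuous φ → (∀ y ∉ Set.Ioo (0 : ℝ) 1, φ y = 0) → (∀ y, 0 ≤ φ y) →
      Tendsto (fun N : ℕ => (N : ℝ)⁻¹ * ∑ k ∈ Finset.Icc 1 N, φ (x k) * w k) atTop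
        (𝓝 (L * ∫ y in (0 : ℝ)..1, φ y))) :
    Tendsto (fun N : ℕ => (N : ℝ)⁻¹ * ∑ k ∈ Finset.Icc 1 N, I.indicator 1 (x k) * w k) atTop
      (𝓝 (L * volume.real I)) := by
  have hC : 0 ≤ C := (abs_nonneg _).trans (hw 0)
  set U := interior I with hU
  set V := interior Iᶜ ∩ Set.Ioo 0 1 with hV
  have hU01 : U ⊆ Set.Ioo 0 1 := by
    rw [← interior_Ico]; exact interior_mono hI01
  have hUvol : volume.real U = volume.real I :=
    measureReal_congr (interior_ae_eq_of_null_frontier hfr)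
  have hVvol : volume.real V = 1 - volume.real I := by
    have h3 : V =ᵐ[volume] (Iᶜ ∩ Set.Ico 0 1 : Set ℝ) :=
      (interior_ae_eq_of_null_frontier (by rwa [frontier_compl])).inter Ioo_ae_eq_Ico
    rw [measureReal_congr h3, Set.inter_comm, ← Set.sdiff_eq, measureReal_sdiff hI01 hIm (by simp)]
    simp
  rw [Metric.tendsto_nhds]
  intro ε' hε'
  have hden : 0 < 2 * C + |L| + 1 := by positivity
  obtain ⟨ε, hε, hεε'⟩ : ∃ ε > 0, (2 * C + |L| + 1) * ε = ε' :=
    ⟨ε' / (2 * C + |L| + 1), by positivity, by field_simp⟩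
  obtain ⟨φ, hφc, hφ0, hφ1, hφU, hφlt, hφle⟩ :=
    exists_continuous_le_indicator_of_isOpen isOpen_interior hU01 hε
  obtain ⟨ψ, hψc, hψ0, hψ1, hψV, hψlt, hψle⟩ :=
    exists_continuous_le_indicator_of_isOpen (isOpen_interior.inter isOpen_Ioo)
      (Set.inter_subset_right : V ⊆ _) hε
  have hφ01 : ∀ y ∉ Set.Ioo (0 : ℝ) 1, φ y = 0 := fun y hy => hφU y fun h => hy (hU01 h)
  have hψ01 : ∀ y ∉ Set.Ioo (0 : ℝ) 1, ψ y = 0 := fun y hy => hψV y fun h => hy h.2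
  have hkey (y : ℝ) : |I.indicator 1 y - φ y| ≤ 1 - φ y - ψ y := by
    by_cases hy : y ∈ I
    · rw [hψV y fun h => interior_subset h.1 hy, Set.indicator_of_mem hy, Pi.one_apply,
        abs_of_nonneg (by linarith [hφ1 y])]
      linarith
    · rw [hφU y fun h => hy (interior_subset h), Set.indicator_of_notMem hy]
      simpa using hψ1 y
  have hlim := ((((h1 φ hφc hφ01 hφ0).const_sub 1).sub (h1 ψ hψc hψ01 hψ0)).const_mul C).add
    ((h2 φ hφc hφ01 hφ0).sub_const (L * ∫ y in (0 : ℝ)..1, φ y)).abs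
  rw [sub_self, abs_zero, add_zero] at hlim
  have hlt : C * (1 - (∫ y in (0 : ℝ)..1, φ y) - ∫ y in (0 : ℝ)..1, ψ y) < (2 * C + 1) * ε := by
    rw [hUvol] at hφlt
    rw [hVvol] at hψlt
    nlinarith
  filter_upwards [hlim.eventually_lt_const hlt, eventually_gt_atTop 0] with N hN hN0
  have hN0' : (0 : ℝ) < N := by exact_mod_cast hN0
  have hA : |(N : ℝ)⁻¹ * ∑ k ∈ Finset.Icc 1 N, I.indicator 1 (x k) * w k
      - (N : ℝ)⁻¹ * ∑ k ∈ Finset.Icc 1 N, φ (x k) * w k|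
      ≤ C * (1 - (N : ℝ)⁻¹ * ∑ k ∈ Finset.Icc 1 N, φ (x k)
        - (N : ℝ)⁻¹ * ∑ k ∈ Finset.Icc 1 N, ψ (x k)) := by
    have h3 : C * (1 - (N : ℝ)⁻¹ * ∑ k ∈ Finset.Icc 1 N, φ (x k)
        - (N : ℝ)⁻¹ * ∑ k ∈ Finset.Icc 1 N, ψ (x k))
        = (N : ℝ)⁻¹ * ∑ k ∈ Finset.Icc 1 N, (1 - φ (x k) - ψ (x k)) * C := by
      rw [← Finset.sum_mul, Finset.sum_sub_distrib, Finset.sum_sub_distrib, Finset.sum_const,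
        Nat.card_Icc, Nat.add_sub_cancel, nsmul_eq_mul, mul_one]
      field_simp
    rw [h3, ← mul_sub, ← Finset.sum_sub_distrib, abs_mul, abs_of_pos (inv_pos.2 hN0')]
    gcongr
    refine (Finset.abs_sum_le_sum_abs _ _).trans (Finset.sum_le_sum fun k _ => ?_)
    rw [← sub_mul, abs_mul]
    exact mul_le_mul (hkey _) (hw k) (abs_nonneg _) ((abs_nonneg _).trans (hkey _))
  have hB : |L * (∫ y in (0 : ℝ)..1, φ y) - L * volume.real I| ≤ |L| * ε := by
    rw [← mul_sub, abs_mul]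
    gcongr
    rw [abs_le]
    constructor <;> linarith
  rw [Real.dist_eq]
  have h4 := abs_sub_le ((N : ℝ)⁻¹ * ∑ k ∈ Finset.Icc 1 N, I.indicator 1 (x k) * w k)
    ((N : ℝ)⁻¹ * ∑ k ∈ Finset.Icc 1 N, φ (x k) * w k) (L * volume.real I)
  have h5 := abs_sub_le ((N : ℝ)⁻¹ * ∑ k ∈ Finset.Icc 1 N, φ (x k) * w k)
    (L * ∫ y in (0 : ℝ)..1, φ y) (L * volume.real I)
  linarith

lemma IsFinUnionIntervals.measurableSet {I : Set ℝ} (hI : IsFinUnionIntervals I) :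
    MeasurableSet I := by
  obtain ⟨s, rfl⟩ := hI
  exact s.measurableSet_biUnion fun _ _ => measurableSet_Ico

lemma IsFinUnionIntervals.volume_frontier {I : Set ℝ} (hI : IsFinUnionIntervals I) :
    volume (frontier I) = 0 := by
  obtain ⟨s, rfl⟩ := hI
  classical
  induction s using Finset.induction_on with
  | empty => simp
  | insert p s _ ih =>
    rw [Finset.set_biUnion_insert]
    refine measure_mono_null (frontier_union_subset _ _) (measure_union_null ?_ ?_)
    · exact measure_mono_null Set.inter_subset_left ((convex_Ico _ _).addHaar_frontier _)
    · exact measure_mono_null Set.inter_subset_right ih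

end Sandwich

theorem stmt3 {Ω : Type*} [MeasurableSpace Ω]
    (T : Ω → Ω) (μ : Measure Ω) [IsProbabilityMeasure μ]
    (hT : MeasurePreserving T μ μ) (hwm : WeakMixing T μ)
    (α : ℝ) (hα : Irrational α) (hα01 : α ∈ Set.Ioo (0 : ℝ) 1)
    (I : Set ℝ) (hI : IsFinUnionIntervals I) (hI01 : I ⊆ Set.Ico (0 : ℝ) 1)
    (F : Ω → ℝ) (hFmeas : Measurable F) (hFbd : ∃ C : ℝ, ∀ ω, |F ω| ≤ C) :
    ∃ Ω' : Set Ω, μ Ω' = 1 ∧ ∀ ω ∈ Ω', ∀ t ∈ Set.Ico (0 : ℝ) 1,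
      Tendsto (fun N : ℕ => (N : ℝ)⁻¹ *
          ∑ k ∈ Finset.Icc 1 N,
            Set.indicator I (1 : ℝ → ℝ) (Int.fract (t + k * α)) * F (T^[lk α t k] ω))
        atTop (𝓝 ((volume I).toReal * ∫ ω', F ω' ∂μ)) := by
  obtain ⟨C, hC⟩ := hFbd
  have : Fact (0 < α) := ⟨hα01.1⟩
  set c := ∫ ω', F ω' ∂μ with hc
  have hFi : Integrable F μ := Integrable.of_bound hFmeas.aestronglyMeasurable C
    (Eventually.of_forall hC)
  have hb (ω : Ω) : |F ω - c| ≤ C + |c| := (abs_sub _ _).trans (by gcongr; exact hC ω)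
  have hae : ∀ᵐ ω ∂μ, ∀ m : ℤ, Tendsto (fun N : ℕ => (N : ℂ)⁻¹ * ∑ n ∈ Finset.range N,
      fourier m ((-1 : ℝ) : AddCircle α) ^ n * ((F (T^[n] ω) - c : ℝ) : ℂ)) atTop (𝓝 0) := by
    refine ae_all_iff.2 fun m => hwm.ae_tendsto_twisted_average hT
      (f := fun ω => ((F ω - c : ℝ) : ℂ)) (C := C + |c|)
      (by rw [fourier_apply]; exact Circle.norm_coe _)
      (by fun_prop) (fun ω => by rw [Complex.norm_real]; exact hb ω) ?_
    refine (integral_ofReal (𝕜 := ℂ) (f := fun ω => F ω - c)).trans ?_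
    rw [integral_sub hFi (integrable_const c)]
    simp [hc]
  refine ⟨{ω | ∀ m : ℤ, Tendsto (fun N : ℕ => (N : ℂ)⁻¹ * ∑ n ∈ Finset.range N,
      fourier m ((-1 : ℝ) : AddCircle α) ^ n * ((F (T^[n] ω) - c : ℝ) : ℂ)) atTop (𝓝 0)},
    (measure_congr (eventuallyEq_univ.2 hae)).trans measure_univ, fun ω hω t ht => ?_⟩
  rw [mul_comm]
  refine tendsto_average_indicator_of_null_frontier hI.measurableSet hI01 hI.volume_frontier
    (x := fun k => Int.fract (t + k * α)) (w := fun k => F (T^[lk α t k] ω)) (C := C) (L := c)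
    (fun k => hC _) ?_ ?_
  · intro φ hφ h0 _
    exact hα.tendsto_average_fract t hφ (by rw [h0 0 (by simp), h0 1 (by simp)])
  · intro φ hφ h0 hpos
    have h1 := hα.tendsto_average_fract t hφ (by rw [h0 0 (by simp), h0 1 (by simp)])
    have h2 := tendsto_average_fract_mul_of_twisted hα01.2 hφ h0 hpos
      (b := fun n => F (T^[n] ω) - c) (fun n => hb _) hω ht
    have h3 := h2.add (h1.const_mul c)
    rw [zero_add] at h3
    refine h3.congr fun N => ?_
    simp only [mul_sub, Finset.sum_sub_distrib, ← Finset.sum_mul]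
    ring
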